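/- Let F_q be a finite field with q elements. For d ≥ 0, identify the set of effective divisors of degree d on the projective line over F_q with the set of nonzero homogeneous polynomials of degree d in two variables over F_q modulo multiplication by nonzero scalars. For (d1, d2, d3) ∈ ℕ^3 let S(d1, d2, d3) = Σ q^{deg gcd(F1, F2, F3)}, the sum ranging over all triples of such classes with F_i homogeneous of degree d_i (the total degree of a gcd of the F_i in F_q[X,Y] is independent of the chosen representatives). Then there exists a real number c > 0 such that q^{−(d1+d2+d3)}·S(d1, d2, d3) tends to c as min(d1, d2, d3) tends to infinity, i.e. for every ε > 0 there is N such that min(d1,d2,d3) ≥ N implies |q^{−(d1+d2+d3)}·S(d1,d2,d3) − c| < ε. -/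

import Mathlib

open MvPolynomial

/-- The homogeneous polynomial of degree `d` in the two variables `X 0`, `X 1` with coefficient
tuple `c : Fin (d+1) → k`, namely `∑_{j=0}^{d} c_j (X 0)^j (X 1)^{d-j}`.  Nonzero homogeneous
polynomials of degree `d` in two variables correspond bijectively to nonzero such tuples. -/
noncomputable def binForm {k : Type*} [CommSemiring k] (d : ℕ) (c : Fin (d + 1) → k) :
    MvPolynomial (Fin 2) k :=
  ∑ j : Fin (d + 1), MvPolynomial.C (c j) * MvPolynomial.X 0 ^ (j : ℕ) *
    MvPolynomial.X 1 ^ (d - (j : ℕ))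


theorem MvPolynomial.coe_order_eq_of_isHomogeneous {σ R : Type*} [CommSemiring R]
    {f : MvPolynomial σ R} (hf : f ≠ 0) {n : ℕ} (h : f.IsHomogeneous n) :
    (f : MvPowerSeries σ R).order = n := by
  obtain ⟨d, hd⟩ := MvPolynomial.ne_zero_iff.mp hf
  have hdn : d.degree = n := by
    by_contra hne
    exact hd (h.coeff_eq_zero hne)
  refine le_antisymm ?_ ?_
  · rw [← hdn]
    exact MvPowerSeries.order_le (by simpa using hd)
  · refine MvPowerSeries.nat_le_order fun e he => ?_
    rw [MvPolynomial.coeff_coe]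
    exact h.coeff_eq_zero he.ne

theorem MvPolynomial.coe_order_le_totalDegree {σ R : Type*} [CommSemiring R]
    {f : MvPolynomial σ R} (hf : f ≠ 0) :
    (f : MvPowerSeries σ R).order ≤ f.totalDegree := by
  obtain ⟨d, hd⟩ := MvPolynomial.ne_zero_iff.mp hf
  refine (MvPowerSeries.order_le (d := d) (by simpa using hd)).trans ?_
  exact_mod_cast MvPolynomial.le_totalDegree (MvPolynomial.mem_support_iff.mpr hd)

theorem MvPolynomial.isHomogeneous_totalDegree_of_le_order {σ R : Type*} [CommSemiring R]
    {f : MvPolynomial σ R} (h : (f.totalDegree : ℕ∞) ≤ (f : MvPowerSeries σ R).order) :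
    f.IsHomogeneous f.totalDegree := by
  intro d hd
  rw [Pi.one_def, ← Finsupp.degree_eq_weight_one]
  refine le_antisymm (MvPolynomial.le_totalDegree (MvPolynomial.mem_support_iff.mpr hd)) ?_
  have := h.trans (MvPowerSeries.order_le (d := d) (by simpa using hd))
  exact_mod_cast this

theorem MvPolynomial.IsHomogeneous.of_mul_left {σ R : Type*} [CommRing R] [IsDomain R]
    {f g : MvPolynomial σ R} {n : ℕ} (h : (f * g).IsHomogeneous n) (h0 : f * g ≠ 0) :
    f.IsHomogeneous f.totalDegree := by
  have hf := left_ne_zero_of_mul h0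
  have hg := right_ne_zero_of_mul h0
  have hn : f.totalDegree + g.totalDegree = n := by
    rw [← MvPolynomial.totalDegree_mul_of_isDomain hf hg, h.totalDegree h0]
  have ho := MvPolynomial.coe_order_eq_of_isHomogeneous h0 h
  rw [MvPolynomial.coe_mul, MvPowerSeries.order_mul, ← hn] at ho
  have h1 := MvPolynomial.coe_order_le_totalDegree hf
  have h2 := MvPolynomial.coe_order_le_totalDegree hg
  apply MvPolynomial.isHomogeneous_totalDegree_of_le_order
  generalize (f : MvPowerSeries σ R).order = a at *
  generalize (g : MvPowerSeries σ R).order = b at *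
  lift a to ℕ using ne_top_of_le_ne_top (ENat.natCast_ne_top _) h1
  lift b to ℕ using ne_top_of_le_ne_top (ENat.natCast_ne_top _) h2
  norm_cast at *
  omega

section Forms

variable {k : Type*} [Field k]

theorem binForm_eq_sum_monomial (d : ℕ) (c : Fin (d + 1) → k) :
    binForm d c = ∑ j : Fin (d + 1),
      monomial (Finsupp.single 0 (j : ℕ) + Finsupp.single 1 (d - (j : ℕ))) (c j) := by
  refine Finset.sum_congr rfl fun j _ => ?_
  rw [MvPolynomial.X_pow_eq_monomial, MvPolynomial.X_pow_eq_monomial, MvPolynomial.C_mul_monomial,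
    MvPolynomial.monomial_mul, mul_one, mul_one]

theorem isHomogeneous_binForm (d : ℕ) (c : Fin (d + 1) → k) : (binForm d c).IsHomogeneous d := by
  rw [binForm_eq_sum_monomial]
  refine MvPolynomial.IsHomogeneous.sum _ _ _ fun j _ => MvPolynomial.isHomogeneous_monomial _ ?_
  have := j.is_lt
  simp only [map_add, Finsupp.degree_single]
  omega

theorem coeff_binForm (d : ℕ) (c : Fin (d + 1) → k) (i : Fin (d + 1)) :
    coeff (Finsupp.single 0 (i : ℕ) + Finsupp.single 1 (d - (i : ℕ))) (binForm d c) = c i := by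
  rw [binForm_eq_sum_monomial, MvPolynomial.coeff_sum, Finset.sum_eq_single i]
  · rw [MvPolynomial.coeff_monomial, if_pos rfl]
  · intro j _ hj
    rw [MvPolynomial.coeff_monomial, if_neg]
    intro h
    have := DFunLike.congr_fun h 0
    simp at this
    exact hj (Fin.ext this)
  · simp

theorem binForm_injective (d : ℕ) : Function.Injective (binForm (k := k) d) := by
  intro c c' h
  ext i
  rw [← coeff_binForm d c, h, coeff_binForm]

theorem binForm_zero (d : ℕ) : binForm d (0 : Fin (d + 1) → k) = 0 := by
  simp [binForm]

theorem MvPolynomial.IsHomogeneous.exists_binForm_eq {F : MvPolynomial (Fin 2) k} {d : ℕ}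
    (hF : F.IsHomogeneous d) : ∃ c, binForm d c = F := by
  refine ⟨fun j => coeff (Finsupp.single 0 (j : ℕ) + Finsupp.single 1 (d - (j : ℕ))) F, ?_⟩
  ext m
  by_cases hm : m.degree = d
  · have hm' : m 0 + m 1 = d := by
      rw [← hm, Finsupp.degree_eq_sum, Fin.sum_univ_two]
    have hms : m = Finsupp.single 0 (m 0) + Finsupp.single 1 (d - m 0) := by
      ext i
      fin_cases i
      · simp
      · simp; omega
    rw [hms]
    exact coeff_binForm d _ ⟨m 0, by omega⟩
  · rw [(isHomogeneous_binForm d _).coeff_eq_zero hm, hF.coeff_eq_zero hm]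

theorem totalDegree_eq_of_associated {G H : MvPolynomial (Fin 2) k} (h : Associated G H) :
    G.totalDegree = H.totalDegree := by
  obtain ⟨u, rfl⟩ := h
  rcases eq_or_ne G 0 with rfl | hG
  · simp
  · rw [MvPolynomial.totalDegree_mul_of_isDomain hG u.ne_zero,
      (MvPolynomial.isUnit_iff_totalDegree_of_isReduced.mp u.isUnit).2, add_zero]

variable [Fintype k]

open Classical in
/-- The nonzero binary forms of degree `d`. -/
noncomputable def nonzeroForms (k : Type*) [Field k] [Fintype k] (d : ℕ) :
    Finset (MvPolynomial (Fin 2) k) :=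
  (Finset.univ.filter fun c : Fin (d + 1) → k => c ≠ 0).map ⟨binForm d, binForm_injective d⟩

theorem mem_nonzeroForms {d : ℕ} {F : MvPolynomial (Fin 2) k} :
    F ∈ nonzeroForms k d ↔ F ≠ 0 ∧ F.IsHomogeneous d := by
  classical
  simp only [nonzeroForms, Finset.mem_map, Function.Embedding.coeFn_mk, Finset.mem_filter, Finset.mem_univ, true_and]
  constructor
  · rintro ⟨c, hc, rfl⟩
    refine ⟨fun h => hc (binForm_injective d (h.trans (binForm_zero d).symm)),
      isHomogeneous_binForm d c⟩
  · rintro ⟨h0, hF⟩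
    obtain ⟨c, rfl⟩ := hF.exists_binForm_eq
    exact ⟨c, fun hc => h0 (by rw [hc, binForm_zero]), rfl⟩

theorem sum_nonzeroForms [DecidableEq k] {M : Type*} [AddCommMonoid M] (d : ℕ)
    (f : MvPolynomial (Fin 2) k → M) :
    ∑ F ∈ nonzeroForms k d, f F =
      ∑ c ∈ Finset.univ.filter (fun c : Fin (d + 1) → k => c ≠ 0), f (binForm d c) := by
  rw [nonzeroForms, Finset.sum_map]
  congr!

theorem card_nonzeroForms (d : ℕ) :
    ((nonzeroForms k d).card : ℝ) = (Fintype.card k : ℝ) ^ (d + 1) - 1 := by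
  classical
  rw [nonzeroForms, Finset.card_map,
    Finset.filter_ne' Finset.univ (0 : Fin (d + 1) → k),
    Finset.card_erase_of_mem (Finset.mem_univ _), Finset.card_univ,
    Nat.cast_sub Fintype.card_pos]
  simp

theorem mul_mem_nonzeroForms_iff {d e : ℕ} {G F : MvPolynomial (Fin 2) k}
    (hG : G ∈ nonzeroForms k e) : G * F ∈ nonzeroForms k (e + d) ↔ F ∈ nonzeroForms k d := by
  rw [mem_nonzeroForms] at hG
  rw [mem_nonzeroForms, mem_nonzeroForms]
  constructor
  · rintro ⟨h0, h⟩
    have hF := right_ne_zero_of_mul h0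
    refine ⟨hF, ?_⟩
    have h1 : F.totalDegree = d := by
      have := h.totalDegree h0
      rw [MvPolynomial.totalDegree_mul_of_isDomain hG.1 hF, hG.2.totalDegree hG.1] at this
      omega
    rw [mul_comm] at h h0
    exact h1 ▸ h.of_mul_left h0
  · rintro ⟨h0, h⟩
    exact ⟨mul_ne_zero hG.1 h0, hG.2.mul h⟩

theorem mem_nonzeroForms_totalDegree_of_dvd {d : ℕ} {G F : MvPolynomial (Fin 2) k}
    (hF : F ∈ nonzeroForms k d) (h : G ∣ F) :
    G ∈ nonzeroForms k G.totalDegree ∧ G.totalDegree ≤ d := by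
  obtain ⟨H, rfl⟩ := h
  rw [mem_nonzeroForms] at hF
  refine ⟨mem_nonzeroForms.mpr ⟨left_ne_zero_of_mul hF.1, hF.2.of_mul_left hF.1⟩, ?_⟩
  rw [← hF.2.totalDegree hF.1, MvPolynomial.totalDegree_mul_of_isDomain
    (left_ne_zero_of_mul hF.1) (right_ne_zero_of_mul hF.1)]
  exact Nat.le_add_right _ _

open Classical in
theorem card_associated_nonzeroForms {e : ℕ} {H : MvPolynomial (Fin 2) k}
    (hH : H ∈ nonzeroForms k e) :
    (((nonzeroForms k e).filter fun G => Associated G H).card : ℝ) = (Fintype.card k : ℝ) - 1 := by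
  have h : (nonzeroForms k e).filter (fun G => Associated G H) =
      (Finset.univ : Finset kˣ).image fun u : kˣ => C (u : k) * H := by
    ext G
    simp only [Finset.mem_filter, Finset.mem_image, Finset.mem_univ, true_and]
    constructor
    · rintro ⟨-, hGH⟩
      obtain ⟨u, rfl⟩ := hGH.symm
      obtain ⟨r, hr, hu⟩ := MvPolynomial.isUnit_iff_eq_C_of_isReduced.mp u.isUnit
      exact ⟨hr.unit, by rw [hu, mul_comm]; rfl⟩
    · rintro ⟨u, rfl⟩
      rw [mem_nonzeroForms] at hH ⊢
      refine ⟨⟨mul_ne_zero (by simp) hH.1, hH.2.C_mul _⟩, ?_⟩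
      exact (associated_isUnit_mul_left_iff (u.isUnit.map C)).mpr (Associated.refl H)
  rw [h, Finset.card_image_of_injective, Finset.card_univ, Fintype.card_units,
    Nat.cast_sub Fintype.card_pos, Nat.cast_one]
  intro u v huv
  exact Units.ext (C_injective _ _ (mul_right_cancel₀ (mem_nonzeroForms.mp hH).1 huv))

end Forms

section Gcd

variable {M : Type*}

/-- `g` picks a greatest common divisor of every triple. -/
def IsTernaryGcd [CommMonoid M] (g : M → M → M → M) : Prop :=
  (∀ a b c, g a b c ∣ a ∧ g a b c ∣ b ∧ g a b c ∣ c) ∧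
    ∀ a b c p, p ∣ a → p ∣ b → p ∣ c → p ∣ g a b c

theorem IsTernaryGcd.associated_mul [CommMonoidWithZero M] [IsCancelMulZero M]
    {g : M → M → M → M} (hg : IsTernaryGcd g) {r : M} (hr : r ≠ 0) (a b c : M) :
    Associated (g (r * a) (r * b) (r * c)) (r * g a b c) := by
  obtain ⟨h, hh⟩ := hg.2 (r * a) (r * b) (r * c) r ⟨a, rfl⟩ ⟨b, rfl⟩ ⟨c, rfl⟩
  obtain ⟨ha, hb, hc⟩ := hg.1 (r * a) (r * b) (r * c)
  obtain ⟨ha', hb', hc'⟩ := hg.1 a b c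
  refine associated_of_dvd_dvd ?_ (hg.2 _ _ _ _ (mul_dvd_mul_left r ha')
    (mul_dvd_mul_left r hb') (mul_dvd_mul_left r hc'))
  rw [hh] at ha hb hc ⊢
  exact mul_dvd_mul_left r (hg.2 _ _ _ _ ((mul_dvd_mul_iff_left hr).mp ha)
    ((mul_dvd_mul_iff_left hr).mp hb) ((mul_dvd_mul_iff_left hr).mp hc))

theorem IsTernaryGcd.associated_mul_iff_isUnit [CommMonoidWithZero M] [IsCancelMulZero M]
    {g : M → M → M → M} (hg : IsTernaryGcd g) {r : M} (hr : r ≠ 0) (a b c : M) :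
    Associated r (g (r * a) (r * b) (r * c)) ↔ IsUnit (g a b c) := by
  have h := hg.associated_mul hr a b c
  constructor
  · intro h'
    have h1 : Associated (r * 1) (r * g a b c) := by simpa using h'.trans h
    exact (h1.of_mul_left (Associated.refl r) hr).isUnit isUnit_one
  · intro h'
    exact ((associated_mul_isUnit_left_iff h').mpr (Associated.refl r)).symm.trans h.symm

end Gcd

section Counting

variable {k : Type*} [Field k] [Fintype k]
  {g : MvPolynomial (Fin 2) k → MvPolynomial (Fin 2) k → MvPolynomial (Fin 2) k →
    MvPolynomial (Fin 2) k}

/-- Triples of nonzero binary forms of degrees `d₁`, `d₂`, `d₃`. -/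
noncomputable def formTriples (k : Type*) [Field k] [Fintype k] (d₁ d₂ d₃ : ℕ) :
    Finset (MvPolynomial (Fin 2) k × MvPolynomial (Fin 2) k × MvPolynomial (Fin 2) k) :=
  nonzeroForms k d₁ ×ˢ nonzeroForms k d₂ ×ˢ nonzeroForms k d₃

open Classical in
/-- The number of triples of nonzero binary forms of degrees `d₁`, `d₂`, `d₃` without common
factor. -/
noncomputable def coprimeCount (g : MvPolynomial (Fin 2) k → MvPolynomial (Fin 2) k →
    MvPolynomial (Fin 2) k → MvPolynomial (Fin 2) k) (d₁ d₂ d₃ : ℕ) : ℕ :=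
  ((formTriples k d₁ d₂ d₃).filter fun F => IsUnit (g F.1 F.2.1 F.2.2)).card

open Classical in
theorem card_formTriples_filter_associated (hg : IsTernaryGcd g) {e : ℕ}
    {G : MvPolynomial (Fin 2) k} (hG : G ∈ nonzeroForms k e) (d₁ d₂ d₃ : ℕ) :
    ((formTriples k (e + d₁) (e + d₂) (e + d₃)).filter
      fun F => Associated G (g F.1 F.2.1 F.2.2)).card = coprimeCount g d₁ d₂ d₃ := by
  have hG0 := (mem_nonzeroForms.mp hG).1
  symm
  refine Finset.card_bij (fun F _ => (G * F.1, G * F.2.1, G * F.2.2)) ?_ ?_ ?_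
  · rintro ⟨F₁, F₂, F₃⟩ hF
    simp only [formTriples, Finset.mem_filter, Finset.mem_product] at hF ⊢
    simpa only [mul_mem_nonzeroForms_iff hG, hg.associated_mul_iff_isUnit hG0] using hF
  · rintro ⟨F₁, F₂, F₃⟩ - ⟨F₁', F₂', F₃'⟩ - h
    simpa [hG0] using h
  · rintro ⟨F₁, F₂, F₃⟩ hF
    simp only [formTriples, Finset.mem_filter, Finset.mem_product] at hF
    obtain ⟨hF, ha⟩ := hF
    obtain ⟨h₁, h₂, h₃⟩ := hg.1 F₁ F₂ F₃
    obtain ⟨F₁', rfl⟩ := ha.dvd.trans h₁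
    obtain ⟨F₂', rfl⟩ := ha.dvd.trans h₂
    obtain ⟨F₃', rfl⟩ := ha.dvd.trans h₃
    refine ⟨(F₁', F₂', F₃'), ?_, rfl⟩
    simp only [formTriples, Finset.mem_filter, Finset.mem_product]
    rw [hg.associated_mul_iff_isUnit hG0] at ha
    simp only [mul_mem_nonzeroForms_iff hG] at hF
    exact ⟨hF, ha⟩

open Classical in
theorem sum_formTriples_weight (hg : IsTernaryGcd g) (w : ℕ → ℝ) (x₁ x₂ x₃ m : ℕ)
    (hx : min x₁ (min x₂ x₃) = 0) :
    ((Fintype.card k : ℝ) - 1) * ∑ F ∈ formTriples k (x₁ + m) (x₂ + m) (x₃ + m),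
        w (g F.1 F.2.1 F.2.2).totalDegree =
      ∑ e ∈ Finset.range (m + 1), w e * ((Fintype.card k : ℝ) ^ (e + 1) - 1) *
        coprimeCount g (x₁ + (m - e)) (x₂ + (m - e)) (x₃ + (m - e)) := by
  have hF : ∀ F ∈ formTriples k (x₁ + m) (x₂ + m) (x₃ + m),
      ((Fintype.card k : ℝ) - 1) * w (g F.1 F.2.1 F.2.2).totalDegree =
        ∑ e ∈ Finset.range (m + 1), ∑ G ∈ nonzeroForms k e,
          if Associated G (g F.1 F.2.1 F.2.2) then w e else 0 := by
    rintro ⟨F₁, F₂, F₃⟩ hF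
    simp only [formTriples, Finset.mem_product] at hF
    obtain ⟨h₁, h₂, h₃⟩ := hg.1 F₁ F₂ F₃
    have hm : (g F₁ F₂ F₃).totalDegree ≤ m := by
      have := (mem_nonzeroForms_totalDegree_of_dvd hF.1 h₁).2
      have := (mem_nonzeroForms_totalDegree_of_dvd hF.2.1 h₂).2
      have := (mem_nonzeroForms_totalDegree_of_dvd hF.2.2 h₃).2
      omega
    rw [Finset.sum_eq_single_of_mem (g F₁ F₂ F₃).totalDegree (by simpa [Nat.lt_succ_iff] using hm)]
    · rw [← Finset.sum_filter, Finset.sum_const, nsmul_eq_mul,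
        card_associated_nonzeroForms (mem_nonzeroForms_totalDegree_of_dvd hF.1 h₁).1]
    · intro e _ he
      refine Finset.sum_eq_zero fun G hG => if_neg fun hGg => he ?_
      rw [← totalDegree_eq_of_associated hGg]
      obtain ⟨hG0, hGe⟩ := mem_nonzeroForms.mp hG
      exact (hGe.totalDegree hG0).symm
  rw [Finset.mul_sum, Finset.sum_congr rfl hF, Finset.sum_comm]
  refine Finset.sum_congr rfl fun e he => ?_
  rw [Finset.sum_comm, ← card_nonzeroForms, mul_comm (w e), mul_assoc, ← nsmul_eq_mul,
    ← Finset.sum_const]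
  refine Finset.sum_congr rfl fun G hG => ?_
  rw [← Finset.sum_filter, Finset.sum_const, nsmul_eq_mul, mul_comm (w e),
    ← card_formTriples_filter_associated hg hG]
  have he' : e ≤ m := Nat.lt_succ_iff.mp (Finset.mem_range.mp he)
  have hadd (x : ℕ) : e + (x + (m - e)) = x + m := by omega
  simp only [hadd]

theorem one_lt_cast_card : (1 : ℝ) < Fintype.card k := by
  exact_mod_cast Fintype.one_lt_card

/-- The sum of `q ^ deg gcd` over triples of nonzero forms satisfies a first order recursion when
all three degrees grow by one. -/
theorem sum_formTriples_card_pow_succ (hg : IsTernaryGcd g) (x₁ x₂ x₃ m : ℕ)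
    (hx : min x₁ (min x₂ x₃) = 0) :
    ∑ F ∈ formTriples k (x₁ + (m + 1)) (x₂ + (m + 1)) (x₃ + (m + 1)),
        (Fintype.card k : ℝ) ^ (g F.1 F.2.1 F.2.2).totalDegree =
      (Fintype.card k : ℝ) ^ 2 * ∑ F ∈ formTriples k (x₁ + m) (x₂ + m) (x₃ + m),
          (Fintype.card k : ℝ) ^ (g F.1 F.2.1 F.2.2).totalDegree +
        (formTriples k (x₁ + (m + 1)) (x₂ + (m + 1)) (x₃ + (m + 1))).card -
        (formTriples k (x₁ + m) (x₂ + m) (x₃ + m)).card := by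
  have hq : (Fintype.card k : ℝ) - 1 ≠ 0 := (sub_pos.mpr one_lt_cast_card).ne'
  have h₁ := sum_formTriples_weight hg (fun e => (Fintype.card k : ℝ) ^ e) x₁ x₂ x₃ m hx
  have h₂ := sum_formTriples_weight hg (fun e => (Fintype.card k : ℝ) ^ e) x₁ x₂ x₃ (m + 1) hx
  have h₃ := sum_formTriples_weight hg (fun _ => 1) x₁ x₂ x₃ m hx
  have h₄ := sum_formTriples_weight hg (fun _ => 1) x₁ x₂ x₃ (m + 1) hx
  rw [Finset.sum_range_succ'] at h₂ h₄
  simp only [Nat.add_sub_add_right, Finset.sum_const, nsmul_eq_mul, mul_one, one_mul] at h₁ h₂ h₃ h₄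
  apply mul_left_cancel₀ hq
  rw [h₂, show ∀ q a b c : ℝ, (q - 1) * (q ^ 2 * a + b - c) =
      q ^ 2 * ((q - 1) * a) + (q - 1) * b - (q - 1) * c by intros; ring, h₁, h₃, h₄,
    Finset.mul_sum, pow_zero, one_mul, ← sub_eq_zero,
    show ∀ a b c d e : ℝ, a + b - (c + (d + b) - e) = a - c - d + e by intros; ring,
    ← Finset.sum_sub_distrib, ← Finset.sum_sub_distrib, ← Finset.sum_add_distrib]
  refine Finset.sum_eq_zero fun e _ => ?_
  ring

theorem sum_formTriples_card_pow_zero (hg : IsTernaryGcd g) (x₁ x₂ x₃ : ℕ)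
    (hx : min x₁ (min x₂ x₃) = 0) :
    ∑ F ∈ formTriples k x₁ x₂ x₃, (Fintype.card k : ℝ) ^ (g F.1 F.2.1 F.2.2).totalDegree =
      (formTriples k x₁ x₂ x₃).card := by
  have hq : (Fintype.card k : ℝ) - 1 ≠ 0 := (sub_pos.mpr one_lt_cast_card).ne'
  have h₁ := sum_formTriples_weight hg (fun e => (Fintype.card k : ℝ) ^ e) x₁ x₂ x₃ 0 hx
  have h₃ := sum_formTriples_weight hg (fun _ => 1) x₁ x₂ x₃ 0 hx
  apply mul_left_cancel₀ hq
  simp only [add_zero, zero_add, Finset.sum_range_one, pow_zero, Finset.sum_const, nsmul_eq_mul,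
    mul_one] at h₁ h₃
  rw [h₁, h₃]

end Counting

section Limit

/-- If `ν` approaches `q ^ 3` at rate `q ^ (-m)` and `t (m + 1) = t m / q + ν (m + 1) - ν m / q ^ 3`,
then `t` approaches the fixed point `q (q² + q + 1)` at rate `m q ^ (-m)`. -/
theorem abs_sub_le_of_recursion {q : ℝ} (hq : 1 < q) {t ν : ℕ → ℝ}
    (h0 : t 0 = ν 0) (hν : ∀ m, |ν m - q ^ 3| ≤ 3 * q ^ 2 * q⁻¹ ^ m)
    (hrec : ∀ m, t (m + 1) = q⁻¹ * t m + ν (m + 1) - (q⁻¹) ^ 3 * ν m) (m : ℕ) :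
    |t m - q * (q ^ 2 + q + 1)| ≤ 6 * q ^ 2 * ((m + 1) * q⁻¹ ^ m) := by
  have hq0 : 0 < q := by linarith
  induction m with
  | zero =>
    have h := abs_le.mp (hν 0)
    simp only [pow_zero, mul_one] at h
    rw [h0]
    simp only [pow_zero, mul_one, Nat.cast_zero, zero_add]
    rw [abs_le]
    constructor <;> nlinarith
  | succ m ih =>
    have e : t (m + 1) - q * (q ^ 2 + q + 1) = q⁻¹ * (t m - q * (q ^ 2 + q + 1)) +
        (ν (m + 1) - q ^ 3) - (q⁻¹) ^ 3 * (ν m - q ^ 3) := by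
      rw [hrec]
      field_simp
      ring
    have hi : (0 : ℝ) < q⁻¹ := inv_pos.mpr hq0
    have hi1 : q⁻¹ ≤ 1 := inv_le_one_of_one_le₀ hq.le
    have hp : 0 < q⁻¹ ^ m := pow_pos hi m
    have hcube : q⁻¹ ^ 3 ≤ q⁻¹ := by
      simpa using pow_le_pow_of_le_one hi.le hi1 (show 1 ≤ 3 by norm_num)
    rw [e]
    refine (abs_sub _ _).trans ((add_le_add_left (abs_add_le _ _) _).trans ?_)
    rw [abs_mul, abs_mul, abs_of_pos hi, abs_of_pos (pow_pos hi 3)]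
    calc q⁻¹ * |t m - q * (q ^ 2 + q + 1)| + |ν (m + 1) - q ^ 3| + q⁻¹ ^ 3 * |ν m - q ^ 3|
        ≤ q⁻¹ * (6 * q ^ 2 * ((m + 1) * q⁻¹ ^ m)) + 3 * q ^ 2 * q⁻¹ ^ (m + 1) +
          q⁻¹ * (3 * q ^ 2 * q⁻¹ ^ m) := by
          gcongr
          · exact hν _
          · exact hν _
      _ = 6 * q ^ 2 * (((m + 1 : ℕ) + 1) * q⁻¹ ^ (m + 1)) := by
          push_cast
          ring

theorem abs_mul_mul_sub_one_le {q : ℝ} (hq : 1 < q) {x₁ x₂ x₃ m : ℕ} (h₁ : m ≤ x₁)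
    (h₂ : m ≤ x₂) (h₃ : m ≤ x₃) :
    |(q ^ (x₁ + x₂ + x₃))⁻¹ * ((q ^ (x₁ + 1) - 1) * (q ^ (x₂ + 1) - 1) * (q ^ (x₃ + 1) - 1)) -
      q ^ 3| ≤ 3 * q ^ 2 * q⁻¹ ^ m := by
  have hq0 : 0 < q := by linarith
  have hi : (0 : ℝ) < q⁻¹ := inv_pos.mpr hq0
  have hi1 : q⁻¹ ≤ 1 := inv_le_one_of_one_le₀ hq.le
  have key (x : ℕ) (hx : m ≤ x) : 0 ≤ q⁻¹ ^ x ∧ q⁻¹ ^ x ≤ 1 ∧ q⁻¹ ^ x ≤ q⁻¹ ^ m :=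
    ⟨(pow_pos hi x).le, pow_le_one₀ hi.le hi1, pow_le_pow_of_le_one hi.le hi1 hx⟩
  have e : (q ^ (x₁ + x₂ + x₃))⁻¹ *
      ((q ^ (x₁ + 1) - 1) * (q ^ (x₂ + 1) - 1) * (q ^ (x₃ + 1) - 1)) =
      (q - q⁻¹ ^ x₁) * (q - q⁻¹ ^ x₂) * (q - q⁻¹ ^ x₃) := by
    simp only [inv_pow]
    field_simp
    ring
  rw [e]
  obtain ⟨a0, a1, am⟩ := key x₁ h₁
  obtain ⟨b0, b1, bm⟩ := key x₂ h₂
  obtain ⟨c0, c1, cm⟩ := key x₃ h₃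
  generalize q⁻¹ ^ x₁ = a at *
  generalize q⁻¹ ^ x₂ = b at *
  generalize q⁻¹ ^ x₃ = c at *
  generalize q⁻¹ ^ m = p at *
  have e' : (q - a) * (q - b) * (q - c) - q ^ 3 =
      -(q ^ 2 * c + q * b * (q - c) + a * ((q - b) * (q - c))) := by ring
  have hc : 0 ≤ q - c := by linarith
  have hb : 0 ≤ q - b := by linarith
  have hp : 0 ≤ p := a0.trans am
  rw [e', abs_neg, abs_of_nonneg (by positivity)]
  calc q ^ 2 * c + q * b * (q - c) + a * ((q - b) * (q - c))
      ≤ q ^ 2 * p + q * p * q + p * (q * q) := by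
        gcongr <;> first | positivity | linarith
    _ = 3 * q ^ 2 * p := by ring

end Limit

theorem card_formTriples {k : Type*} [Field k] [Fintype k] (d₁ d₂ d₃ : ℕ) :
    ((formTriples k d₁ d₂ d₃).card : ℝ) = ((Fintype.card k : ℝ) ^ (d₁ + 1) - 1) *
      ((Fintype.card k : ℝ) ^ (d₂ + 1) - 1) * ((Fintype.card k : ℝ) ^ (d₃ + 1) - 1) := by
  simp only [formTriples, Finset.card_product, Nat.cast_mul, card_nonzeroForms, mul_assoc]

/-- The normalized sum of `q ^ deg gcd` over triples of nonzero forms is within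
`O((m + 1) q ^ (-m))` of `q (q² + q + 1)`, where `m` is the smallest degree. -/
theorem abs_sum_formTriples_sub_le {k : Type*} [Field k] [Fintype k]
    {g : MvPolynomial (Fin 2) k → MvPolynomial (Fin 2) k → MvPolynomial (Fin 2) k →
      MvPolynomial (Fin 2) k} (hg : IsTernaryGcd g) {q : ℝ} (hq : (Fintype.card k : ℝ) = q)
    (d₁ d₂ d₃ : ℕ) :
    |(q ^ (d₁ + d₂ + d₃))⁻¹ *
        ∑ F ∈ formTriples k d₁ d₂ d₃, q ^ (g F.1 F.2.1 F.2.2).totalDegree -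
      q * (q ^ 2 + q + 1)| ≤
      6 * q ^ 2 * (((min d₁ (min d₂ d₃) : ℕ) + 1) * q⁻¹ ^ min d₁ (min d₂ d₃)) := by
  subst hq
  obtain ⟨m, hm⟩ : ∃ m, m = min d₁ (min d₂ d₃) := ⟨_, rfl⟩
  obtain ⟨x₁, rfl⟩ : ∃ x, d₁ = x + m := ⟨d₁ - m, by omega⟩
  obtain ⟨x₂, rfl⟩ : ∃ x, d₂ = x + m := ⟨d₂ - m, by omega⟩
  obtain ⟨x₃, rfl⟩ : ∃ x, d₃ = x + m := ⟨d₃ - m, by omega⟩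
  have hx : min x₁ (min x₂ x₃) = 0 := by omega
  have hq : (1 : ℝ) < Fintype.card k := one_lt_cast_card
  have hq0 : (Fintype.card k : ℝ) ≠ 0 := by positivity
  rw [← hm]
  refine abs_sub_le_of_recursion hq
    (t := fun m => ((Fintype.card k : ℝ) ^ (x₁ + m + (x₂ + m) + (x₃ + m)))⁻¹ *
      ∑ F ∈ formTriples k (x₁ + m) (x₂ + m) (x₃ + m),
        (Fintype.card k : ℝ) ^ (g F.1 F.2.1 F.2.2).totalDegree)
    (ν := fun m => ((Fintype.card k : ℝ) ^ (x₁ + m + (x₂ + m) + (x₃ + m)))⁻¹ *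
      (formTriples k (x₁ + m) (x₂ + m) (x₃ + m)).card) ?_ (fun m => ?_) (fun m => ?_) m
  · simp only [add_zero]
    rw [sum_formTriples_card_pow_zero hg _ _ _ hx]
  · rw [card_formTriples]
    exact abs_mul_mul_sub_one_le hq (Nat.le_add_left _ _) (Nat.le_add_left _ _)
      (Nat.le_add_left _ _)
  · rw [sum_formTriples_card_pow_succ hg _ _ _ _ hx,
      show x₁ + (m + 1) + (x₂ + (m + 1)) + (x₃ + (m + 1)) =
        x₁ + m + (x₂ + m) + (x₃ + m) + 3 by ring, pow_add _ _ 3]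
    field_simp

/-- Let `F_q` be a finite field with `q` elements.  For
`(d₁,d₂,d₃) ∈ ℕ³`, let `S(d₁,d₂,d₃)` be the sum of `q^{deg gcd(F₁,F₂,F₃)}` over all triples of
classes of nonzero homogeneous polynomials `Fᵢ` of degree `dᵢ` in two variables modulo nonzero
scalars (i.e. effective divisors of degree `dᵢ` on `ℙ¹`); equivalently, `(q-1)³ · S(d₁,d₂,d₃)`
is the corresponding sum over all triples of nonzero homogeneous polynomials, since each class
has exactly `q - 1` representatives and `deg gcd` only depends on the classes.  Then there is a
real `c > 0` such that `q^{-(d₁+d₂+d₃)} S(d₁,d₂,d₃) → c` as `min(d₁,d₂,d₃) → ∞`. -/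
theorem stmt_12 {k : Type*} [Field k] [Fintype k] [DecidableEq k]
    (gcd3 : MvPolynomial (Fin 2) k → MvPolynomial (Fin 2) k → MvPolynomial (Fin 2) k →
      MvPolynomial (Fin 2) k)
    (hgcd_dvd : ∀ F1 F2 F3, gcd3 F1 F2 F3 ∣ F1 ∧ gcd3 F1 F2 F3 ∣ F2 ∧ gcd3 F1 F2 F3 ∣ F3)
    (hgcd_max : ∀ F1 F2 F3 p, p ∣ F1 → p ∣ F2 → p ∣ F3 → p ∣ gcd3 F1 F2 F3)
    (S : ℕ → ℕ → ℕ → ℝ)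
    (hS : ∀ d1 d2 d3 : ℕ,
      ((Fintype.card k : ℝ) - 1) ^ 3 * S d1 d2 d3 =
        ∑ c1 ∈ Finset.univ.filter (fun c : Fin (d1 + 1) → k => c ≠ 0),
          ∑ c2 ∈ Finset.univ.filter (fun c : Fin (d2 + 1) → k => c ≠ 0),
            ∑ c3 ∈ Finset.univ.filter (fun c : Fin (d3 + 1) → k => c ≠ 0),
              (Fintype.card k : ℝ) ^
                (gcd3 (binForm d1 c1) (binForm d2 c2) (binForm d3 c3)).totalDegree) :
    ∃ c : ℝ, 0 < c ∧ ∀ ε : ℝ, 0 < ε → ∃ N : ℕ, ∀ d1 d2 d3 : ℕ,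
      N ≤ d1 → N ≤ d2 → N ≤ d3 →
        |((Fintype.card k : ℝ) ^ (d1 + d2 + d3))⁻¹ * S d1 d2 d3 - c| < ε := by
  have hg : IsTernaryGcd gcd3 := ⟨hgcd_dvd, hgcd_max⟩
  obtain ⟨q, hq⟩ : ∃ q : ℝ, (Fintype.card k : ℝ) = q := ⟨_, rfl⟩
  have hq1 : 1 < q := hq ▸ one_lt_cast_card
  have hq3 : 0 < (q - 1) ^ 3 := pow_pos (sub_pos.mpr hq1) 3
  have hS' (d1 d2 d3 : ℕ) : S d1 d2 d3 = ((q - 1) ^ 3)⁻¹ *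
      ∑ F ∈ formTriples k d1 d2 d3, q ^ (gcd3 F.1 F.2.1 F.2.2).totalDegree := by
    have h := hS d1 d2 d3
    rw [hq] at h
    rw [eq_inv_mul_iff_mul_eq₀ hq3.ne', h, formTriples, Finset.sum_product, sum_nonzeroForms]
    refine Finset.sum_congr rfl fun c1 _ => ?_
    rw [Finset.sum_product, sum_nonzeroForms]
    refine Finset.sum_congr rfl fun c2 _ => ?_
    rw [sum_nonzeroForms]
  have hlim : Filter.Tendsto (fun m : ℕ => ((q - 1) ^ 3)⁻¹ * (6 * q ^ 2 * ((m + 1) * q⁻¹ ^ m)))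
      Filter.atTop (nhds 0) := by
    have hi : |q⁻¹| < 1 := by
      rw [abs_of_pos (by positivity)]
      exact inv_lt_one_of_one_lt₀ hq1
    have h := ((tendsto_self_mul_const_pow_of_abs_lt_one hi).add
      (tendsto_pow_atTop_nhds_zero_of_abs_lt_one hi)).const_mul (((q - 1) ^ 3)⁻¹ * (6 * q ^ 2))
    simp only [add_zero, mul_zero] at h
    refine h.congr fun m => ?_
    ring
  refine ⟨((q - 1) ^ 3)⁻¹ * (q * (q ^ 2 + q + 1)), by positivity, fun ε hε => ?_⟩
  obtain ⟨N, hN⟩ := Filter.eventually_atTop.mp (hlim.eventually_lt_const hε)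
  refine ⟨N, fun d1 d2 d3 h1 h2 h3 => ?_⟩
  refine lt_of_le_of_lt ?_ (hN (min d1 (min d2 d3)) (by omega))
  rw [hq, hS', mul_left_comm, ← mul_sub, abs_mul, abs_of_pos (inv_pos.mpr hq3)]
  exact mul_le_mul_of_nonneg_left (abs_sum_formTriples_sub_le hg hq d1 d2 d3) (by positivity)
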